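/- Let P = (x₁,…,xₙ : r₁,…,r_m) be a finite presentation of a group G satisfying condition (2.1) with distinct orders q₁,…,q_p, and let w be a word in x₁,…,xₙ with [w] ≠ 1 in G. Then the group G_w presented by Q_w is nontrivial. -/

import Mathlib

/-- Generators of the presentation `Q_w`: `Sum.inl i` is the generator `xᵢ`
(for `i : Fin n`), while `Sum.inr 0 = a`, `Sum.inr 1 = α`, `Sum.inr 2 = b`,
`Sum.inr 3 = β`. -/
abbrev QwGen (n : ℕ) := Fin n ⊕ Fin 4

/-- The relators of the presentation `Q_w`: the relators `r₁, …, r_m` (indexed by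
`Sum.inl j`), the relators (iii)/(iv) (indexed by `Sum.inr (Sum.inl i)`, zero-based:
for `i < p` the relator `a^{-qᵢ} xᵢ α^{qᵢ} (β^{-(i+1)} b β^{i+1})⁻¹` and for
`p ≤ i < n` the relator `a^{-(q+i+1)} xᵢ α^{q+i+1} (β^{-(i+1)} b β^{i+1})⁻¹`, where
`q = max {q₁, …, q_p}`), and the relators (i), (ii), (v)
(indexed by `Sum.inr (Sum.inr t)` for `t = 0, 1, 2`). -/
def qwRel (n m p : ℕ) (r : Fin m → FreeGroup (Fin n)) (q : Fin p → ℕ)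
    (w : FreeGroup (Fin n)) : Fin m ⊕ (Fin n ⊕ Fin 3) → FreeGroup (QwGen n) :=
  let a : FreeGroup (QwGen n) := FreeGroup.of (Sum.inr 0)
  let al : FreeGroup (QwGen n) := FreeGroup.of (Sum.inr 1)
  let b : FreeGroup (QwGen n) := FreeGroup.of (Sum.inr 2)
  let be : FreeGroup (QwGen n) := FreeGroup.of (Sum.inr 3)
  let x : Fin n → FreeGroup (QwGen n) := fun i => FreeGroup.of (Sum.inl i)
  let W : FreeGroup (QwGen n) := FreeGroup.map Sum.inl w
  let Q : ℕ := Finset.univ.sup q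
  fun j => match j with
  | Sum.inl j => FreeGroup.map Sum.inl (r j)
  | Sum.inr (Sum.inl i) =>
      if h : (i : ℕ) < p then
        a ^ (-(q ⟨i, h⟩ : ℤ)) * x i * al ^ (q ⟨i, h⟩) *
          (be ^ (-((i : ℕ) + 1 : ℤ)) * b * be ^ ((i : ℕ) + 1))⁻¹
      else
        a ^ (-((Q + (i : ℕ) + 1 : ℕ) : ℤ)) * x i * al ^ (Q + (i : ℕ) + 1) *
          (be ^ (-((i : ℕ) + 1 : ℤ)) * b * be ^ ((i : ℕ) + 1))⁻¹
  | Sum.inr (Sum.inr t) =>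
      if t = 0 then a * al * a⁻¹ * (b ^ 2)⁻¹
      else if t = 1 then al * a * al⁻¹ * (b * be * b⁻¹)⁻¹
      else (W * al ^ 2 * W⁻¹ * (al ^ 2)⁻¹) *
        (be ^ (-((n : ℤ) + 1)) * b * be ^ (n + 1))⁻¹

open scoped Pointwise

/-- A group `K` acting on a set of reduced words over the free product `G * ⟨s⟩ * ⟨t⟩`, together
with the functions reading off the leading syllable of a word in each of the three factors. -/
structure LeadingSyllables (G K S : Type) [Group G] [Group K] [MulAction K S] where
  /-- the embedding of the factor `G` -/
  incl : G →* K
  /-- the generator of the first cyclic factor -/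
  s : K
  /-- the generator of the second cyclic factor -/
  t : K
  /-- the leading syllable in `G` -/
  leadG : S → G
  /-- the exponent of the leading power of `s` -/
  leadS : S → ℤ
  /-- the exponent of the leading power of `t` -/
  leadT : S → ℤ
  /-- the empty word -/
  nil : S
  leadG_smul : ∀ g u, leadG (incl g • u) = g * leadG u
  leadS_smul : ∀ (k : ℤ) u, leadS (s ^ k • u) = k + leadS u
  leadT_smul : ∀ (k : ℤ) u, leadT (t ^ k • u) = k + leadT u
  leadS_or_leadT : ∀ u, leadS u = 0 ∨ leadT u = 0
  leadG_or_leadS : ∀ u, leadG u = 1 ∨ leadS u = 0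
  leadG_or_leadT : ∀ u, leadG u = 1 ∨ leadT u = 0
  leadG_nil : leadG nil = 1
  leadS_nil : leadS nil = 0
  leadT_nil : leadT nil = 0

namespace LeadingSyllables

variable {G K S : Type} [Group G] [Group K] [MulAction K S] (L : LeadingSyllables G K S)

/-- The images in `G * ⟨s⟩ * ⟨t⟩` of a basis of the amalgamated free subgroup. -/
def basisLeft {n : ℕ} (x : Fin n → G) (k : Fin n → ℕ) (g : G) : Fin n ⊕ Fin 3 → K :=
  Sum.elim (fun i => L.s ^ (-(k i : ℤ)) * L.incl (x i) * L.t ^ (k i : ℤ))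
    ![L.s ^ (1 : ℤ) * L.t ^ (1 : ℤ) * L.s ^ (-1 : ℤ),
      L.t ^ (1 : ℤ) * L.s ^ (1 : ℤ) * L.t ^ (-1 : ℤ),
      L.incl g * L.t ^ (2 : ℤ) * L.incl g⁻¹ * L.t ^ (-2 : ℤ)]

/-- The images in `⟨s⟩ * ⟨t⟩` of a basis of the amalgamated free subgroup. -/
def basisRight (n : ℕ) : Fin n ⊕ Fin 3 → K :=
  Sum.elim (fun i => L.t ^ (-((i : ℤ) + 1)) * L.s ^ (1 : ℤ) * L.t ^ ((i : ℤ) + 1))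
    ![L.s ^ (2 : ℤ), L.s ^ (1 : ℤ) * L.t ^ (1 : ℤ) * L.s ^ (-1 : ℤ),
      L.t ^ (-((n : ℤ) + 1)) * L.s ^ (1 : ℤ) * L.t ^ ((n : ℤ) + 1)]

theorem basisLeft_inl {n : ℕ} (x : Fin n → G) (k : Fin n → ℕ) (g : G) (i : Fin n) :
    L.basisLeft x k g (Sum.inl i) = L.s ^ (-(k i : ℤ)) * L.incl (x i) * L.t ^ k i := by
  simp [basisLeft]

theorem basisRight_inl {n : ℕ} (i : Fin n) :
    L.basisRight n (Sum.inl i) = L.t ^ (-((i : ℤ) + 1)) * L.s * L.t ^ ((i : ℕ) + 1) := by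
  rw [← zpow_natCast]
  simp [basisRight]

theorem basisLeft_inr {n : ℕ} (x : Fin n → G) (k : Fin n → ℕ) (g : G) (i : Fin 3) :
    L.basisLeft x k g (Sum.inr i) = ![L.s * L.t * L.s⁻¹, L.t * L.s * L.t⁻¹,
      L.incl g * L.t ^ 2 * (L.incl g)⁻¹ * (L.t ^ 2)⁻¹] i := by
  fin_cases i
  · simp [basisLeft]
  · simp [basisLeft]
  · simp [basisLeft, zpow_neg, zpow_ofNat]

theorem basisRight_inr (n : ℕ) (i : Fin 3) :
    L.basisRight n (Sum.inr i) = ![L.s ^ 2, L.s * L.t * L.s⁻¹,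
      L.t ^ (-((n : ℤ) + 1)) * L.s * L.t ^ (n + 1)] i := by
  fin_cases i
  · simp [basisRight, zpow_ofNat]
  · simp [basisRight]
  · simp only [basisRight, ← zpow_natCast]
    simp

theorem injective_lift_of_ping_pong {ι : Type} [Nontrivial ι] (f : ι → K) (X Y : ι → Set S)
    (hnil : ∀ i, L.nil ∉ Y i)
    (hXdisj : ∀ i j u, u ∈ X i → u ∈ X j → i = j)
    (hYdisj : ∀ i j u, u ∈ Y i → u ∈ Y j → i = j)
    (hXYdisj : ∀ i j u, u ∈ X i → u ∉ Y j)
    (hX : ∀ i u, u ∉ Y i → f i • u ∈ X i)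
    (hY : ∀ i u, u ∉ X i → (f i)⁻¹ • u ∈ Y i) :
    Function.Injective (FreeGroup.lift f) := by
  refine FreeGroup.injective_lift_of_ping_pong f X Y (fun i => ⟨_, hX i _ (hnil i)⟩)
    ?_ ?_ ?_ ?_ ?_
  · exact fun i j hij => Set.disjoint_left.2 fun u h h' => hij (hXdisj i j u h h')
  · exact fun i j hij => Set.disjoint_left.2 fun u h h' => hij (hYdisj i j u h h')
  · exact fun i j => Set.disjoint_left.2 fun u => hXYdisj i j u
  · rintro i _ ⟨u, hu, rfl⟩
    exact hX i u hu
  · rintro i _ ⟨u, hu, rfl⟩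
    exact hY i u hu

theorem leadS_smul_t (k : ℤ) (u : S) (h : k + L.leadT u ≠ 0) : L.leadS (L.t ^ k • u) = 0 := by
  have := L.leadS_or_leadT (L.t ^ k • u)
  have := L.leadT_smul k u
  grind

theorem leadT_smul_s (k : ℤ) (u : S) (h : k + L.leadS u ≠ 0) : L.leadT (L.s ^ k • u) = 0 := by
  have := L.leadS_or_leadT (L.s ^ k • u)
  have := L.leadS_smul k u
  grind

theorem leadG_smul_t (k : ℤ) (u : S) (h : k + L.leadT u ≠ 0) : L.leadG (L.t ^ k • u) = 1 := by
  have := L.leadG_or_leadT (L.t ^ k • u)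
  have := L.leadT_smul k u
  grind

theorem leadS_smul_incl_of_leadS {g : G} {u : S} (hs : L.leadS u = 0) (hg : L.leadG u = 1) :
    L.leadS (L.incl g • u) = 0 := by
  by_cases h : g = 1
  · simpa [h] using hs
  · have := L.leadG_or_leadS (L.incl g • u)
    rw [L.leadG_smul, hg, mul_one] at this
    tauto

theorem leadT_smul_incl_of_leadT {g : G} {u : S} (ht : L.leadT u = 0) (hg : L.leadG u = 1) :
    L.leadT (L.incl g • u) = 0 := by
  by_cases h : g = 1
  · simpa [h] using ht
  · have := L.leadG_or_leadT (L.incl g • u)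
    rw [L.leadG_smul, hg, mul_one] at this
    tauto

theorem leadG_smul_s (k : ℤ) (u : S) (h : k + L.leadS u ≠ 0) : L.leadG (L.s ^ k • u) = 1 := by
  have := L.leadG_or_leadS (L.s ^ k • u)
  have := L.leadS_smul k u
  grind

theorem leadT_smul_incl {g : G} {u : S} (h : g * L.leadG u ≠ 1) :
    L.leadT (L.incl g • u) = 0 := by
  have := L.leadG_or_leadT (L.incl g • u)
  rw [L.leadG_smul] at this
  tauto

/-- Words with leading power exactly `s ^ k`, followed by a power of `t` of sign `e`. -/
def wordsST (k e : ℤ) : Set S := {u | L.leadS u = k ∧ 0 < e * L.leadT (L.s ^ (-L.leadS u) • u)}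

/-- Words with leading power exactly `t ^ k`, followed by a power of `s` of sign `e`. -/
def wordsTS (k e : ℤ) : Set S := {u | L.leadT u = k ∧ 0 < e * L.leadS (L.t ^ (-L.leadT u) • u)}

theorem smul_mem_wordsST {k e : ℤ} (he : e = 1 ∨ e = -1) {u : S}
    (hu : u ∉ L.wordsST k (-e)) :
    (L.s ^ k * L.t ^ e * L.s ^ (-k)) • u ∈ L.wordsST k e := by
  have h1 := L.leadS_smul (-k) u
  have h2 := L.leadT_smul_s (-k) u
  have h3 := L.leadT_smul e (L.s ^ (-k) • u)
  have h4 := L.leadS_smul_t e (L.s ^ (-k) • u)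
  have h5 := L.leadS_smul k (L.t ^ e • L.s ^ (-k) • u)
  simp only [wordsST, Set.mem_ofPred_eq, mul_smul] at hu ⊢
  have hk : L.leadS (L.s ^ k • L.t ^ e • L.s ^ (-k) • u) = k := by
    rcases he with rfl | rfl <;> grind
  refine ⟨hk, ?_⟩
  rw [hk, ← mul_smul (L.s ^ (-k)) (L.s ^ k), ← zpow_add, neg_add_cancel, zpow_zero, one_smul]
  rcases he with rfl | rfl <;> grind

theorem smul_mem_wordsTS {k e : ℤ} (he : e = 1 ∨ e = -1) {u : S}
    (hu : u ∉ L.wordsTS k (-e)) :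
    (L.t ^ k * L.s ^ e * L.t ^ (-k)) • u ∈ L.wordsTS k e := by
  have h1 := L.leadT_smul (-k) u
  have h2 := L.leadS_smul_t (-k) u
  have h3 := L.leadS_smul e (L.t ^ (-k) • u)
  have h4 := L.leadT_smul_s e (L.t ^ (-k) • u)
  have h5 := L.leadT_smul k (L.s ^ e • L.t ^ (-k) • u)
  simp only [wordsTS, Set.mem_ofPred_eq, mul_smul] at hu ⊢
  have hk : L.leadT (L.t ^ k • L.s ^ e • L.t ^ (-k) • u) = k := by
    rcases he with rfl | rfl <;> grind
  refine ⟨hk, ?_⟩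
  rw [hk, ← mul_smul (L.t ^ (-k)) (L.t ^ k), ← zpow_add, neg_add_cancel, zpow_zero, one_smul]
  rcases he with rfl | rfl <;> grind

theorem conj_inv (a b : K) (k : ℤ) :
    (a ^ k * b ^ (1 : ℤ) * a ^ (-k))⁻¹ = a ^ k * b ^ (-1 : ℤ) * a ^ (-k) := by
  group

theorem injective_lift_basisRight (n : ℕ) :
    Function.Injective (FreeGroup.lift (L.basisRight n)) := by
  have : Nontrivial (Fin n ⊕ Fin 3) := ⟨Sum.inr 0, Sum.inr 1, by simp⟩
  have hnn : ∀ i : ℕ, (i : ℤ) + 1 = - -((i : ℤ) + 1) := by omega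
  refine L.injective_lift_of_ping_pong _
    (Sum.elim (fun i : Fin n => L.wordsTS (-((i : ℤ) + 1)) 1)
      ![{u | 2 ≤ L.leadS u}, L.wordsST 1 1, L.wordsTS (-((n : ℤ) + 1)) 1])
    (Sum.elim (fun i : Fin n => L.wordsTS (-((i : ℤ) + 1)) (-1))
      ![{u | L.leadS u ≤ -1}, L.wordsST 1 (-1), L.wordsTS (-((n : ℤ) + 1)) (-1)])
    ?_ ?_ ?_ ?_ ?_ ?_
  · have := L.leadS_nil
    have := L.leadT_nil
    rintro (i | t) <;> [skip; fin_cases t] <;> simp [wordsST, wordsTS] <;> grind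
  · rintro (i | t) (j | t') u <;>
      [skip; fin_cases t'; fin_cases t; (fin_cases t <;> fin_cases t')] <;>
      have := L.leadS_or_leadT u <;> simp [wordsST, wordsTS] <;> grind
  · rintro (i | t) (j | t') u <;>
      [skip; fin_cases t'; fin_cases t; (fin_cases t <;> fin_cases t')] <;>
      have := L.leadS_or_leadT u <;> simp [wordsST, wordsTS] <;> grind
  · rintro (i | t) (j | t') u <;>
      [skip; fin_cases t'; fin_cases t; (fin_cases t <;> fin_cases t')] <;>
      have := L.leadS_or_leadT u <;> simp [wordsST, wordsTS] <;> grind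
  · rintro (i | t) u hu
    · have := L.smul_mem_wordsTS (Or.inl rfl) hu
      rwa [← hnn] at this
    · fin_cases t
      · replace hu : ¬ L.leadS u ≤ -1 := hu
        change 2 ≤ L.leadS (L.s ^ (2 : ℤ) • u)
        rw [L.leadS_smul]
        omega
      · exact L.smul_mem_wordsST (Or.inl rfl) hu
      · have := L.smul_mem_wordsTS (Or.inl rfl) hu
        rwa [← hnn] at this
  · rintro (i | t) u hu
    · have := L.smul_mem_wordsTS (e := -1) (Or.inr rfl) hu
      rw [← conj_inv, ← hnn] at this
      exact this
    · fin_cases t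
      · replace hu : ¬ 2 ≤ L.leadS u := hu
        change L.leadS ((L.s ^ (2 : ℤ))⁻¹ • u) ≤ -1
        rw [← zpow_neg, L.leadS_smul]
        omega
      · have := L.smul_mem_wordsST (e := -1) (Or.inr rfl) hu
        rw [← conj_inv] at this
        exact this
      · have := L.smul_mem_wordsTS (e := -1) (Or.inr rfl) hu
        rw [← conj_inv, ← hnn] at this
        exact this

theorem injective_lift_basisLeft {n : ℕ} (x : Fin n → G) {k : Fin n → ℕ} (hk : ∀ i, 1 ≤ k i)
    (hinj : Function.Injective k) {g : G} (hg : g ≠ 1) :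
    Function.Injective (FreeGroup.lift (L.basisLeft x k g)) := by
  have : Nontrivial (Fin n ⊕ Fin 3) := ⟨Sum.inr 0, Sum.inr 1, by simp⟩
  refine L.injective_lift_of_ping_pong _
    (Sum.elim (fun i : Fin n => {u | L.leadS u = -(k i : ℤ)})
      ![L.wordsST 1 1, L.wordsTS 1 1, {u | L.leadG u = g}])
    (Sum.elim (fun i : Fin n => {u | L.leadT u = -(k i : ℤ)})
      ![L.wordsST 1 (-1), L.wordsTS 1 (-1),
        {u | L.leadT u = 2 ∧ L.leadG (L.t ^ (-2 : ℤ) • u) = g}])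
    ?_ ?_ ?_ ?_ ?_ ?_
  · have := L.leadS_nil
    have := L.leadT_nil
    rintro (i | t) <;> [skip; fin_cases t] <;> simp [wordsST, wordsTS] <;> grind
  · rintro (i | t) (j | t') u <;>
      [skip; fin_cases t'; fin_cases t; (fin_cases t <;> fin_cases t')] <;>
      have := L.leadS_or_leadT u <;> have := L.leadG_or_leadS u <;>
      have := L.leadG_or_leadT u <;> simp [wordsST, wordsTS] <;> grind [Function.Injective]
  · rintro (i | t) (j | t') u <;>
      [skip; fin_cases t'; fin_cases t; (fin_cases t <;> fin_cases t')] <;>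
      have := L.leadS_or_leadT u <;> have := L.leadG_or_leadS u <;>
      have := L.leadG_or_leadT u <;> simp [wordsST, wordsTS] <;> grind [Function.Injective]
  · rintro (i | t) (j | t') u <;>
      [skip; fin_cases t'; fin_cases t; (fin_cases t <;> fin_cases t')] <;>
      have := L.leadS_or_leadT u <;> have := L.leadG_or_leadS u <;>
      have := L.leadG_or_leadT u <;> simp [wordsST, wordsTS] <;> grind [Function.Injective]
  · rintro (i | t) u hu
    · have h : (k i : ℤ) + L.leadT u ≠ 0 := fun h => hu (eq_neg_of_add_eq_zero_right h)
      have h' := L.leadS_smul_incl_of_leadS (g := x i) (L.leadS_smul_t _ _ h)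
        (L.leadG_smul_t _ _ h)
      simp [basisLeft, mul_smul, -zpow_neg, -zpow_natCast, L.leadS_smul, h']
    · fin_cases t
      · exact L.smul_mem_wordsST (Or.inl rfl) hu
      · exact L.smul_mem_wordsTS (Or.inl rfl) hu
      · change L.leadG ((L.incl g * L.t ^ (2 : ℤ) * L.incl g⁻¹ * L.t ^ (-2 : ℤ)) • u) = g
        replace hu : ¬ (L.leadT u = 2 ∧ L.leadG (L.t ^ (-2 : ℤ) • u) = g) := hu
        have h1 : L.leadG (L.t ^ (-2 : ℤ) • u) ≠ g := by
          have := L.leadG_smul_t (-2) u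
          grind
        have h2 := L.leadT_smul_incl (g := g⁻¹) (u := L.t ^ (-2 : ℤ) • u)
          (by rwa [ne_eq, inv_mul_eq_one, eq_comm])
        simp only [mul_smul]
        rw [L.leadG_smul, L.leadG_smul_t _ _ (by omega), mul_one]
  · rintro (i | t) u hu
    · have h : (k i : ℤ) + L.leadS u ≠ 0 := fun h => hu (eq_neg_of_add_eq_zero_right h)
      have h' := L.leadT_smul_incl_of_leadT (g := (x i)⁻¹) (L.leadT_smul_s _ _ h)
        (L.leadG_smul_s _ _ h)
      change L.leadT ((L.s ^ (-(k i : ℤ)) * L.incl (x i) * L.t ^ (k i : ℤ))⁻¹ • u) = _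
      rw [mul_inv_rev, mul_inv_rev, ← zpow_neg, ← zpow_neg, neg_neg, ← map_inv, mul_smul,
        mul_smul, L.leadT_smul, h', add_zero]
    · fin_cases t
      · have := L.smul_mem_wordsST (e := -1) (Or.inr rfl) hu
        rw [← conj_inv] at this
        exact this
      · have := L.smul_mem_wordsTS (e := -1) (Or.inr rfl) hu
        rw [← conj_inv] at this
        exact this
      · change (L.incl g * L.t ^ (2 : ℤ) * L.incl g⁻¹ * L.t ^ (-2 : ℤ))⁻¹ • u ∈
          {u | L.leadT u = 2 ∧ L.leadG (L.t ^ (-2 : ℤ) • u) = g}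
        have hinv : (L.incl g * L.t ^ (2 : ℤ) * L.incl g⁻¹ * L.t ^ (-2 : ℤ))⁻¹ =
            L.t ^ (2 : ℤ) * L.incl g * L.t ^ (-2 : ℤ) * L.incl g⁻¹ := by
          rw [map_inv]
          group
        replace hu : L.leadG u ≠ g := hu
        have h1 := L.leadT_smul_incl (g := g⁻¹) (u := u) (by rwa [ne_eq, inv_mul_eq_one, eq_comm])
        have h2 := L.leadG_smul_t (-2) (L.incl g⁻¹ • u) (by omega)
        have h3 := L.leadT_smul_incl (g := g) (u := L.t ^ (-2 : ℤ) • L.incl g⁻¹ • u)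
          (by rwa [h2, mul_one])
        rw [hinv]
        simp only [mul_smul, Set.mem_ofPred_eq]
        rw [← mul_smul (L.t ^ (-2 : ℤ)) (L.t ^ (2 : ℤ)), ← zpow_add, neg_add_cancel, zpow_zero,
          one_smul, L.leadT_smul, L.leadG_smul, h2, h3]
        simp

end LeadingSyllables

/-- The factors of the free product `G * ℤ * ℤ`. -/
def TwoCyclicFactors (G : Type) : Option Bool → Type
  | none => G
  | some _ => Multiplicative ℤ

instance (G : Type) [Group G] : ∀ i, Group (TwoCyclicFactors G i)
  | none => inferInstanceAs (Group G)
  | some _ => inferInstanceAs (Group (Multiplicative ℤ))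

open Monoid CoprodI in
/-- Reduced words in `G * ℤ * ℤ` and their leading syllables. -/
noncomputable def leadingSyllables (G : Type) [Group G]
    [∀ i, DecidableEq (TwoCyclicFactors G i)] :
    LeadingSyllables G (CoprodI (TwoCyclicFactors G)) (Word (TwoCyclicFactors G)) :=
  let lead (i : Option Bool) (u : Word (TwoCyclicFactors G)) := (Word.equivPair i u).head
  have lead_or {i j : Option Bool} (hij : i ≠ j) (u) : lead i u = 1 ∨ lead j u = 1 := by
    by_cases h : u.fstIdx = some i
    · right
      simp only [lead]
      rw [Word.equivPair_eq_of_fstIdx_ne (by rw [h]; simpa using hij)]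
    · left
      simp only [lead]
      rw [Word.equivPair_eq_of_fstIdx_ne h]
  have lead_smul (i : Option Bool) (m : TwoCyclicFactors G i) (u) :
      lead i (of m • u) = m * lead i u := by
    simp only [lead, Word.equivPair_smul_same]
  have lead_nil (i : Option Bool) : lead i Word.empty = 1 := by
    simp only [lead]
    rw [Word.equivPair_eq_of_fstIdx_ne (by simp [Word.fstIdx, Word.empty])]
  let exponent (c : Bool) (u : Word (TwoCyclicFactors G)) : ℤ :=
    Multiplicative.toAdd (α := ℤ) (lead (some c) u)
  let gen (c : Bool) : TwoCyclicFactors G (some c) := Multiplicative.ofAdd (1 : ℤ)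
  have exponent_smul (c : Bool) (k : ℤ) (u) :
      exponent c (of (gen c) ^ k • u) = k + exponent c u := by
    simp only [exponent]
    rw [← map_zpow, lead_smul]
    change Multiplicative.toAdd (Multiplicative.ofAdd (1 : ℤ) ^ k *
      Multiplicative.ofAdd (exponent c u)) = k + exponent c u
    rw [toAdd_mul, toAdd_zpow, toAdd_ofAdd, toAdd_ofAdd, smul_eq_mul, mul_one]
  { incl := (of : TwoCyclicFactors G none →* _)
    s := of (gen true)
    t := of (gen false)
    leadG := lead none
    leadS := exponent true
    leadT := exponent false
    nil := Word.empty
    leadG_smul := lead_smul none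
    leadS_smul := exponent_smul true
    leadT_smul := exponent_smul false
    leadS_or_leadT := lead_or (by simp)
    leadG_or_leadS := lead_or (by simp)
    leadG_or_leadT := lead_or (by simp)
    leadG_nil := lead_nil none
    leadS_nil := lead_nil (some true)
    leadT_nil := lead_nil (some false) }

/-- The exponents of `a` and `α` in the relators for the generators `xᵢ`. -/
def qwExponent (n p : ℕ) (q : Fin p → ℕ) (i : Fin n) : ℕ :=
  if h : (i : ℕ) < p then q ⟨i, h⟩ else Finset.univ.sup q + i + 1

theorem one_le_qwExponent {n p : ℕ} {q : Fin p → ℕ} (hq : ∀ i, 1 ≤ q i) (i : Fin n) :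
    1 ≤ qwExponent n p q i := by
  unfold qwExponent
  split
  · exact hq _
  · omega

theorem qwExponent_injective {n p : ℕ} {q : Fin p → ℕ} (hq : Function.Injective q) :
    Function.Injective (qwExponent n p q) := by
  intro i j h
  have hle (l : Fin p) : q l ≤ Finset.univ.sup q := Finset.le_sup (Finset.mem_univ l)
  unfold qwExponent at h
  split at h <;> split at h
  · simpa [Fin.ext_iff] using hq h
  · have := hle ⟨i, by assumption⟩
    omega
  · have := hle ⟨j, by assumption⟩
    omega
  · omega

/-- Let `P = (x₁,…,xₙ : r₁,…,r_m)` be a finite presentation of a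
group `G = PresentedGroup (Set.range r)` satisfying condition (2.1) with distinct
orders `q₁,…,q_p`, and let `w` be a word in `x₁,…,xₙ`.  Then the group `G_w`
presented by `Q_w` is nontrivial whenever `[w] ≠ 1` in `G`. -/
theorem qw_nontrivial_of_word_nontrivial (n m p : ℕ) (hp1 : 1 ≤ p) (hpn : p ≤ n)
    (r : Fin m → FreeGroup (Fin n)) (q : Fin p → ℕ)
    (hq1 : ∀ i, 1 ≤ q i) (hqinj : Function.Injective q)
    (horder : ∀ i : Fin p,
      orderOf (Abelianization.of
        (PresentedGroup.of (rels := Set.range r) (Fin.castLE hpn i))) = q i)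
    (hgcd : Finset.univ.gcd q = 1)
    (w : FreeGroup (Fin n)) (hw : PresentedGroup.mk (Set.range r) w ≠ 1) :
    Nontrivial (PresentedGroup (Set.range (qwRel n m p r q w))) := by
  classical
  let G := PresentedGroup (Set.range r)
  let L := leadingSyllables G
  let x : Fin n → G := PresentedGroup.of
  let k := qwExponent n p q
  let φ : Bool → FreeGroup (Fin n ⊕ Fin 3) →* Monoid.CoprodI (TwoCyclicFactors G) := fun c =>
    FreeGroup.lift (if c then L.basisLeft x k (PresentedGroup.mk _ w) else L.basisRight n)
  have hφ : ∀ c, Function.Injective (φ c) := by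
    rintro (_ | _)
    · exact L.injective_lift_basisRight n
    · exact L.injective_lift_basisLeft x (one_le_qwExponent hq1) (qwExponent_injective hqinj) hw
  let left : Monoid.CoprodI (TwoCyclicFactors G) →* Monoid.PushoutI φ :=
    Monoid.PushoutI.of (φ := φ) true
  let right : Monoid.CoprodI (TwoCyclicFactors G) →* Monoid.PushoutI φ :=
    Monoid.PushoutI.of (φ := φ) false
  have hglue (j) : left (L.basisLeft x k (PresentedGroup.mk _ w) j) = right (L.basisRight n j) := by
    have h := (Monoid.PushoutI.of_apply_eq_base φ true (FreeGroup.of j)).trans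
      (Monoid.PushoutI.of_apply_eq_base φ false (FreeGroup.of j)).symm
    simpa [φ] using h
  let gen : QwGen n → Monoid.PushoutI φ :=
    Sum.elim (fun i => left (L.incl (x i))) ![left L.s, left L.t, right L.s, right L.t]
  have hgen (v : FreeGroup (Fin n)) : FreeGroup.lift gen (FreeGroup.map Sum.inl v) =
      left (L.incl (PresentedGroup.mk _ v)) := by
    change ((FreeGroup.lift gen).comp (FreeGroup.map Sum.inl)) v =
      (left.comp (L.incl.comp (PresentedGroup.mk _))) v
    congr 1
    ext i
    simp [gen, x, PresentedGroup.of]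
  have hrel : ∀ v ∈ Set.range (qwRel n m p r q w), FreeGroup.lift gen v = 1 := by
    rintro _ ⟨j | i | t, rfl⟩
    · have : PresentedGroup.mk (Set.range r) (r j) = 1 :=
        PresentedGroup.one_of_mem (Set.mem_range_self j)
      simp [qwRel, hgen, this]
    · have h := hglue (Sum.inl i)
      simp only [L.basisLeft_inl, L.basisRight_inl, map_mul, map_zpow, map_pow, k,
        qwExponent] at h
      simp only [qwRel]
      split at h
      · rw [dif_pos ‹_›]
        simp only [map_mul, map_inv, map_zpow, map_pow, FreeGroup.lift_apply_of]
        exact mul_inv_eq_one.2 h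
      · rw [dif_neg ‹_›]
        simp only [map_mul, map_inv, map_zpow, map_pow, FreeGroup.lift_apply_of]
        exact mul_inv_eq_one.2 h
    · have h := hglue (Sum.inr t)
      simp only [L.basisLeft_inr, L.basisRight_inr] at h
      fin_cases t
      all_goals
        simp only [qwRel, map_mul, map_inv, map_zpow, map_pow, hgen, FreeGroup.lift_apply_of,
          Fin.isValue, Fin.reduceFinMk, Fin.reduceEq, Fin.zero_eta, Fin.mk_one, reduceIte,
          Matrix.cons_val] at h ⊢
        exact mul_inv_eq_one.2 h
  have hs : L.s ≠ 1 := by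
    intro h
    have := L.leadS_smul 1 L.nil
    simp [h] at this
  refine ⟨PresentedGroup.of (Sum.inr 0), 1, fun h => hs ?_⟩
  apply Monoid.PushoutI.of_injective hφ true
  have := congrArg (PresentedGroup.toGroup hrel) h
  simpa [gen] using this
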